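/- Let σ be an operator connection that is not a scalar multiple of the right-trivial mean (A,B) ↦ B, and let g be the representing function of the transpose connection (A,B) ↦ B σ A. Given an invertible positive operator A > 0 and B ≥ 0, the operator equation X σ A = B has a positive solution X ≥ 0 if and only if the spectrum of A^{-1/2} B A^{-1/2} is contained in the range of g. In that case, the solution is unique and given by X = A^{1/2} g^{-1}(A^{-1/2} B A^{-1/2}) A^{1/2}, where g^{-1} denotes the inverse of g on its range, applied via the continuous functional calculus. -/

import Mathlib

open ContinuousLinearMap Filter Topology MeasureTheory
open scoped NNReal ENNReal

set_option synthInstance.maxHeartbeats 1000000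
set_option maxHeartbeats 1000000

noncomputable section

variable {H : Type} [NormedAddCommGroup H] [InnerProductSpace ℂ H] [CompleteSpace H]

/-- Convergence of a sequence of bounded operators in the strong operator topology. -/
def SOTTendsto (A : ℕ → H →L[ℂ] H) (A₀ : H →L[ℂ] H) : Prop :=
  ∀ x : H, Tendsto (fun n => A n x) atTop (𝓝 (A₀ x))

/-- A Kubo–Ando operator connection on the positive bounded operators on `H`:
a binary operation on positive operators (hence positivity of the output) satisfying
monotonicity (M1), the transformer inequality (M2) and continuity from above (M3). -/
structure IsConnection (σ : (H →L[ℂ] H) → (H →L[ℂ] H) → (H →L[ℂ] H)) : Prop where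
  isPositive : ∀ A B : H →L[ℂ] H, A.IsPositive → B.IsPositive → (σ A B).IsPositive
  mono : ∀ A B C D : H →L[ℂ] H, A.IsPositive → B.IsPositive → C.IsPositive → D.IsPositive →
    A ≤ C → B ≤ D → σ A B ≤ σ C D
  transformer : ∀ A B C : H →L[ℂ] H, A.IsPositive → B.IsPositive → C.IsPositive →
    C * σ A B * C ≤ σ (C * A * C) (C * B * C)
  contFromAbove : ∀ (A B : ℕ → H →L[ℂ] H) (A₀ B₀ : H →L[ℂ] H),
    (∀ n, (A n).IsPositive) → (∀ n, (B n).IsPositive) → A₀.IsPositive → B₀.IsPositive →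
    Antitone A → Antitone B → SOTTendsto A A₀ → SOTTendsto B B₀ →
    Antitone (fun n => σ (A n) (B n)) ∧ SOTTendsto (fun n => σ (A n) (B n)) (σ A₀ B₀)

/-- A function `f : [0,∞) → [0,∞)` is operator monotone if for every complex Hilbert
space `K` and all positive bounded operators `A ≤ B` on `K` one has `f(A) ≤ f(B)`,
where `f` is applied via the continuous functional calculus. -/
def OperatorMonotone (f : ℝ≥0 → ℝ≥0) : Prop :=
  ∀ (K : Type) [NormedAddCommGroup K] [InnerProductSpace ℂ K] [CompleteSpace K],
    ∀ A B : K →L[ℂ] K, A.IsPositive → B.IsPositive → A ≤ B → cfc f A ≤ cfc f B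

/-- `f` is the representing function of the connection `σ`: `f` is operator monotone
and `f(x)·I = I σ (x·I)` for all `x ≥ 0`. -/
def IsRepresentingFunction (σ : (H →L[ℂ] H) → (H →L[ℂ] H) → (H →L[ℂ] H))
    (f : ℝ≥0 → ℝ≥0) : Prop :=
  OperatorMonotone f ∧
    ∀ x : ℝ≥0, σ 1 ((x : ℝ) • (1 : H →L[ℂ] H)) = (f x : ℝ) • (1 : H →L[ℂ] H)

/-- The kernel `t ↦ 1 !ₜ x = x / ((1-t)x + t)`, with the conventions
`1 !₀ x = 1` for every `x` (in particular `1 !₀ 0 = 1`) and `1 !ₜ 0 = 0` for `t > 0`. -/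
def harmKernel (t : ℝ) (x : ℝ≥0) : ℝ≥0∞ :=
  if t = 0 then 1 else ENNReal.ofReal ((x : ℝ) / ((1 - t) * (x : ℝ) + t))

/-- `μ` is the associated (finite Borel) measure of a connection with representing
function `f`: `μ` is supported on `[0,1]` and `f(x) = ∫_{[0,1]} (1 !ₜ x) dμ(t)`. -/
def IsAssociatedMeasure (f : ℝ≥0 → ℝ≥0) (μ : Measure ℝ) : Prop :=
  μ (Set.Icc (0:ℝ) 1)ᶜ = 0 ∧
    ∀ x : ℝ≥0, (f x : ℝ≥0∞) = ∫⁻ t in Set.Icc (0:ℝ) 1, harmKernel t x ∂μ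

/-- `g` is the transpose of `f`: `g(x) = x·f(1/x)` for `x > 0`, extended to `0` by
continuity, i.e. `g(0) = lim_{x→0⁺} x·f(1/x)`. -/
def IsTransposeFunction (g f : ℝ≥0 → ℝ≥0) : Prop :=
  (∀ x : ℝ≥0, x ≠ 0 → g x = x * f x⁻¹) ∧
    Tendsto (fun x : ℝ≥0 => x * f x⁻¹) (𝓝[>] (0 : ℝ≥0)) (𝓝 (g 0))

set_option linter.unusedSectionVars false

lemma smul_one_nonneg (x : ℝ≥0) : 0 ≤ (x : ℝ) • (1 : H →L[ℂ] H) :=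
  smul_nonneg x.2 zero_le_one

lemma conjugate_le_of_nonneg {C X Y : H →L[ℂ] H} (hC : 0 ≤ C) (h : X ≤ Y) :
    C * X * C ≤ C * Y * C :=
  (IsSelfAdjoint.of_nonneg hC).conjugate_le_conjugate h

namespace IsConnection

variable {σ : (H →L[ℂ] H) → (H →L[ℂ] H) → (H →L[ℂ] H)}

lemma nonneg (hσ : IsConnection σ) {A B : H →L[ℂ] H} (hA : 0 ≤ A) (hB : 0 ≤ B) : 0 ≤ σ A B := by
  rw [nonneg_iff_isPositive] at *
  exact hσ.isPositive A B hA hB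

lemma le (hσ : IsConnection σ) {A B C D : H →L[ℂ] H} (hA : 0 ≤ A) (hB : 0 ≤ B)
    (hAC : A ≤ C) (hBD : B ≤ D) : σ A B ≤ σ C D := by
  have hC := hA.trans hAC
  have hD := hB.trans hBD
  rw [nonneg_iff_isPositive] at hA hB hC hD
  exact hσ.mono A B C D hA hB hC hD hAC hBD

lemma conjugate_le (hσ : IsConnection σ) {A B C : H →L[ℂ] H} (hA : 0 ≤ A) (hB : 0 ≤ B)
    (hC : 0 ≤ C) : C * σ A B * C ≤ σ (C * A * C) (C * B * C) := by
  rw [nonneg_iff_isPositive] at *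
  exact hσ.transformer A B C hA hB hC

/-- The transformer inequality is an equality for invertible operators. -/
lemma conjugate_eq (hσ : IsConnection σ) {A B C : H →L[ℂ] H} (hA : 0 ≤ A) (hB : 0 ≤ B)
    (hC : 0 ≤ C) (hu : IsUnit C) : C * σ A B * C = σ (C * A * C) (C * B * C) := by
  refine le_antisymm (hσ.conjugate_le hA hB hC) ?_
  obtain ⟨u, rfl⟩ := hu
  have hD : (0 : H →L[ℂ] H) ≤ ↑u⁻¹ := CFC.inv_nonneg_of_nonneg u hC
  have key := hσ.conjugate_le ((IsSelfAdjoint.of_nonneg hC).conjugate_nonneg hA)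
    ((IsSelfAdjoint.of_nonneg hC).conjugate_nonneg hB) hD
  have cancel (Z : H →L[ℂ] H) : (↑u⁻¹ : H →L[ℂ] H) * (u * Z * u) * ↑u⁻¹ = Z := by
    simp [mul_assoc]
  have cancel' (Z : H →L[ℂ] H) : (u : H →L[ℂ] H) * (↑u⁻¹ * Z * ↑u⁻¹) * u = Z := by
    simp [mul_assoc]
  rw [cancel, cancel] at key
  have := conjugate_le_of_nonneg hC key
  rwa [cancel'] at this

lemma tendsto (hσ : IsConnection σ) {A B : ℕ → H →L[ℂ] H} {A₀ B₀ : H →L[ℂ] H}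
    (hA : ∀ n, 0 ≤ A n) (hB : ∀ n, 0 ≤ B n) (hAa : Antitone A) (hBa : Antitone B)
    (hAt : Tendsto A atTop (𝓝 A₀)) (hBt : Tendsto B atTop (𝓝 B₀)) :
    SOTTendsto (fun n => σ (A n) (B n)) (σ A₀ B₀) := by
  have hA₀ : 0 ≤ A₀ := ge_of_tendsto' hAt hA
  have hB₀ : 0 ≤ B₀ := ge_of_tendsto' hBt hB
  simp only [nonneg_iff_isPositive] at *
  exact (hσ.contFromAbove A B A₀ B₀ hA hB hA₀ hB₀ hAa hBa
    (fun x => ((ContinuousLinearMap.apply ℂ H x).continuous.tendsto _).comp hAt)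
    (fun x => ((ContinuousLinearMap.apply ℂ H x).continuous.tendsto _).comp hBt)).2

end IsConnection

lemma SOTTendsto.unique {A : ℕ → H →L[ℂ] H} {A₀ A₁ : H →L[ℂ] H} (h₀ : SOTTendsto A A₀)
    (h₁ : SOTTendsto A A₁) : A₀ = A₁ :=
  ContinuousLinearMap.ext fun x => tendsto_nhds_unique (h₀ x) (h₁ x)

lemma SOTTendsto.of_tendsto {A : ℕ → H →L[ℂ] H} {A₀ : H →L[ℂ] H}
    (h : Tendsto A atTop (𝓝 A₀)) : SOTTendsto A A₀ :=
  fun x => ((ContinuousLinearMap.apply ℂ H x).continuous.tendsto _).comp h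

/-- The sequence `1 / (n + 1)` in `ℝ≥0`. -/
def invSucc (n : ℕ) : ℝ≥0 := 1 / ((n : ℝ≥0) + 1)

lemma invSucc_pos (n : ℕ) : 0 < invSucc n := by unfold invSucc; positivity

lemma invSucc_antitone : Antitone invSucc := fun m n h => by
  unfold invSucc
  gcongr

lemma tendsto_invSucc : Tendsto invSucc atTop (𝓝 0) := by
  rw [← NNReal.tendsto_coe]
  simpa [invSucc] using tendsto_one_div_add_atTop_nhds_zero_nat (𝕜 := ℝ)

lemma tendsto_add_invSucc_smul (E : H →L[ℂ] H) :
    Tendsto (fun n => E + (invSucc n : ℝ) • (1 : H →L[ℂ] H)) atTop (𝓝 E) := by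
  have h := (NNReal.tendsto_coe.2 tendsto_invSucc).smul_const (1 : H →L[ℂ] H)
  simpa using h.const_add E

lemma antitone_add_invSucc_smul (E : H →L[ℂ] H) :
    Antitone (fun n => E + (invSucc n : ℝ) • (1 : H →L[ℂ] H)) := fun m n h => by
  have : (invSucc n : ℝ) ≤ invSucc m := invSucc_antitone h
  exact add_le_add_right (smul_le_smul_of_nonneg_right this zero_le_one) _

lemma isUnit_of_smul_one_le {E : H →L[ℂ] H} {δ : ℝ≥0} (hδ : 0 < δ)
    (h : (δ : ℝ) • (1 : H →L[ℂ] H) ≤ E) : IsUnit E := by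
  refine CStarAlgebra.isUnit_of_le _ h ?_
  have : IsUnit ((δ : ℝ) • (1 : H →L[ℂ] H)) := by
    simpa [Algebra.smul_def] using (isUnit_iff_ne_zero.2 (NNReal.coe_pos.2 hδ).ne').map
      (algebraMap ℝ (H →L[ℂ] H))
  exact this.isStrictlyPositive (smul_one_nonneg δ)

lemma isUnit_add_invSucc_smul {E : H →L[ℂ] H} (hE : 0 ≤ E) (n : ℕ) :
    IsUnit (E + (invSucc n : ℝ) • (1 : H →L[ℂ] H)) :=
  isUnit_of_smul_one_le (invSucc_pos n) (le_add_of_nonneg_left hE)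

/-- If the anticommutator of `φ` with every positive operator commuting with `Y` is positive, then
`φ` commutes with `Y`. -/
lemma commute_of_anticommutator_nonneg {Y φ : H →L[ℂ] H} (hY : IsSelfAdjoint Y)
    (hφ : IsSelfAdjoint φ)
    (h : ∀ k : H →L[ℂ] H, 0 ≤ k → Commute k Y → 0 ≤ k * φ + φ * k) : Commute Y φ := by
  let _ : NormedAlgebra ℚ (H →L[ℂ] H) := NormedAlgebra.restrictScalars ℚ ℂ (H →L[ℂ] H)
  let W : ℂ → H →L[ℂ] H := fun z => NormedSpace.exp (z • Y)
  have hW : ∀ z, HasDerivAt W (W z * Y) z := fun z => hasDerivAt_exp_smul_const Y z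
  have hW' : ∀ z, HasDerivAt (fun z => W (-z)) (-(W (-z) * Y)) z := fun z => by
    have h := (hW (-z)).scomp z (hasDerivAt_neg z)
    rw [neg_smul, one_smul] at h
    exact h
  have hWW (z : ℂ) : W z * W (-z) = 1 := by
    have : Commute (z • Y) (-z • Y) := ((Commute.refl Y).smul_left _).smul_right _
    simp only [W]
    rw [← NormedSpace.exp_add_of_commute this]
    simp
  have hstar (z : ℂ) : star (W z) = W (star z) := by
    simp only [W]
    rw [NormedSpace.star_exp, star_smul, hY.star_eq]
  have hWY (z : ℂ) : Commute (W z) Y := ((Commute.refl Y).smul_left z).exp_left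
  let F : ℂ → H →L[ℂ] H := fun z => W z * φ * W (-z)
  have hF : ∀ z, HasDerivAt F (W z * Y * φ * W (-z) + W z * φ * -(W (-z) * Y)) z := fun z =>
    ((hW z).mul_const φ).mul (hW' z)
  have hre (z : ℂ) (x : H) : 0 ≤ (inner ℂ x (F z x)).re := by
    have hk := h (star (W z) * W z) (star_mul_self_nonneg _)
      (by rw [hstar]; exact (hWY _).mul_left (hWY _))
    have hp := ((nonneg_iff_isPositive _).1 hk).re_inner_nonneg_right (W (-z) x)
    have hx : W z (W (-z) x) = x := by
      rw [← mul_apply_eq_comp, hWW]; simp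
    have e1 : inner ℂ (W (-z) x) ((star (W z) * W z * φ) (W (-z) x)) = inner ℂ x (F z x) := by
      simp only [F, mul_apply_eq_comp, ContinuousLinearMap.star_eq_adjoint,
        ContinuousLinearMap.adjoint_inner_right, hx]
    have e2 : inner ℂ (W (-z) x) ((φ * (star (W z) * W z)) (W (-z) x)) =
      inner ℂ (F z x) x := by
      rw [← hφ.star_eq]
      simp only [F, mul_apply_eq_comp, ContinuousLinearMap.star_eq_adjoint,
        ContinuousLinearMap.adjoint_inner_right, hx]
    rw [add_apply, inner_add_right, e1, e2, map_add,
      inner_re_symm (F z x) x] at hp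
    have : RCLike.re (inner ℂ x (F z x)) = (inner ℂ x (F z x)).re := rfl
    linarith
  have hconst (x : H) : inner ℂ x ((Y * φ - φ * Y) x) = 0 := by
    have hf (z : ℂ) := (innerSL ℂ x).hasFDerivAt.comp_hasDerivAt z
      ((ContinuousLinearMap.apply ℂ H x).hasFDerivAt.comp_hasDerivAt z (hF z))
    have hexp (z : ℂ) := (hf z).neg.cexp
    have hd : Differentiable ℂ fun z => Complex.exp (-inner ℂ x (F z x)) :=
      fun z => (hexp z).differentiableAt
    have hb : Bornology.IsBounded (Set.range fun z => Complex.exp (-inner ℂ x (F z x))) := by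
      refine (Metric.isBounded_closedBall (x := (0 : ℂ)) (r := 1)).subset ?_
      rintro _ ⟨z, rfl⟩
      simpa [Complex.norm_exp] using hre z x
    have hc : (fun z => Complex.exp (-inner ℂ x (F z x))) =
        fun _ => Complex.exp (-inner ℂ x (F 0 x)) :=
      funext fun z => hd.apply_eq_apply_of_bounded hb z 0
    have hz := (hexp 0).unique (hc ▸ hasDerivAt_const (0 : ℂ) (Complex.exp (-inner ℂ x (F 0 x))))
    have hW0 : W 0 = 1 := by simp [W]
    simp [hW0, Complex.exp_ne_zero, sub_eq_add_neg, inner_add_right] at hz ⊢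
    linear_combination -hz
  have hz : ((Y * φ - φ * Y : H →L[ℂ] H) : H →ₗ[ℂ] H) = 0 :=
    (inner_map_self_eq_zero _).1 fun x => by
      rw [← inner_conj_symm]
      exact (congrArg (starRingEnd ℂ) (hconst x)).trans (map_zero _)
  exact sub_eq_zero.1 (ContinuousLinearMap.coe_injective hz)

/-- A self-adjoint `T` commuting with `Y` is nonpositive once it is dominated by functions of `Y`
whose pointwise infimum on the spectrum is nonpositive. -/
lemma nonpos_of_le_cfc {Y T : H →L[ℂ] H} (hY : IsSelfAdjoint Y) (hc : Commute Y T)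
    (h : ∀ s ∈ spectrum ℝ Y, ∀ η : ℝ, 0 < η → ∃ k : ℝ → ℝ, Continuous k ∧ T ≤ cfc k Y ∧ k s < η) :
    T ≤ 0 := by
  have main (η : ℝ) (hη : 0 < η) : T ≤ η • 1 := by
    choose! k hkc hkT hks using fun s hs => h s hs η hη
    obtain ⟨t, ht, hcov⟩ :=
      (ContinuousFunctionalCalculus.isCompact_spectrum (R := ℝ) Y).elim_nhds_subcover
      (fun s => {x | k s x < η}) (fun s hs =>
        (isOpen_lt (hkc s hs) continuous_const).mem_nhds (hks s hs))
    let q : ℝ → ℝ → ℝ := fun s x => max (η - k s x) 0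
    have hqc : ∀ s ∈ t, Continuous (q s) := fun s hs =>
      (continuous_const.sub (hkc s (ht s hs))).max continuous_const
    have hq0 (s x) : 0 ≤ q s x := le_max_right _ _
    let Q : ℝ → ℝ := fun x => ∑ s ∈ t, q s x
    have hQc : Continuous Q := continuous_finsetSum t hqc
    have hQpos : ∀ x ∈ spectrum ℝ Y, 0 < Q x := fun x hx => by
      obtain ⟨s, hs, hsx⟩ := Set.mem_iUnion₂.1 (hcov hx)
      exact Finset.sum_pos' (fun _ _ => hq0 _ _) ⟨s, hs, lt_max_of_lt_left (sub_pos.2 hsx)⟩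
    have hmul : ∀ s ∈ t, cfc (q s) Y * T ≤ η • cfc (q s) Y := fun s hs => by
      have h1 : 0 ≤ cfc (q s) Y * (cfc (k s) Y - T) :=
        Commute.mul_nonneg (cfc_nonneg fun x _ => hq0 s x) (sub_nonneg.2 (hkT s (ht s hs)))
          ((cfc_commute_cfc _ _ _).sub_right (hc.cfc_real _))
      have h2 : cfc (q s) Y * cfc (k s) Y ≤ η • cfc (q s) Y := by
        rw [← cfc_mul (q s) (k s) Y (hqc s hs).continuousOn (hkc s (ht s hs)).continuousOn,
          ← cfc_smul η (q s) Y (hqc s hs).continuousOn]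
        refine cfc_mono (fun x _ => ?_) ((hqc s hs).mul (hkc s (ht s hs))).continuousOn
          ((hqc s hs).const_smul η).continuousOn
        simp only [q, smul_eq_mul]
        rcases le_total (η - k s x) 0 with h | h
        · simp [h]
        · rw [max_eq_left h]; nlinarith
      rw [mul_sub, sub_nonneg] at h1
      exact h1.trans h2
    have hsum : cfc Q Y * T ≤ η • cfc Q Y := by
      have : cfc Q Y = ∑ s ∈ t, cfc (q s) Y := by
        rw [← cfc_sum q Y t fun s hs => (hqc s hs).continuousOn]
        congr 1
        ext x
        simp [Q]
      rw [this, Finset.sum_mul, Finset.smul_sum]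
      exact Finset.sum_le_sum hmul
    have hQi : ContinuousOn (fun x => (Q x)⁻¹) (spectrum ℝ Y) :=
      hQc.continuousOn.inv₀ fun x hx => (hQpos x hx).ne'
    have hinv : cfc (fun x => (Q x)⁻¹) Y * cfc Q Y = 1 := by
      rw [← cfc_mul _ Q Y hQi hQc.continuousOn, ← cfc_one ℝ Y]
      exact cfc_congr fun x hx => inv_mul_cancel₀ (hQpos x hx).ne'
    have h3 : 0 ≤ cfc (fun x => (Q x)⁻¹) Y * (η • cfc Q Y - cfc Q Y * T) :=
      Commute.mul_nonneg (cfc_nonneg fun x hx => (inv_pos.2 (hQpos x hx)).le) (sub_nonneg.2 hsum)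
        (((cfc_commute_cfc _ _ _).smul_right _).sub_right
          ((cfc_commute_cfc _ _ _).mul_right (hc.cfc_real _)))
    rw [mul_sub, mul_smul_comm, ← mul_assoc, hinv, one_mul, sub_nonneg] at h3
    exact h3
  have hlim : Tendsto (fun n => (invSucc n : ℝ) • (1 : H →L[ℂ] H)) atTop (𝓝 0) := by
    simpa using (NNReal.tendsto_coe.2 tendsto_invSucc).smul_const (1 : H →L[ℂ] H)
  exact ge_of_tendsto' hlim fun n => main _ (NNReal.coe_pos.2 (invSucc_pos n))

section Transpose

variable {σ : (H →L[ℂ] H) → (H →L[ℂ] H) → (H →L[ℂ] H)} {g : ℝ≥0 → ℝ≥0}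

lemma connection_smul_self_of_isUnit (hσ : IsConnection σ)
    (hg : ∀ x : ℝ≥0, σ ((x : ℝ) • (1 : H →L[ℂ] H)) 1 = (g x : ℝ) • (1 : H →L[ℂ] H))
    {E : H →L[ℂ] H} (hE : 0 ≤ E) (hu : IsUnit E) (x : ℝ≥0) :
    σ ((x : ℝ) • E) E = (g x : ℝ) • E := by
  have h := hσ.conjugate_eq (smul_one_nonneg x) zero_le_one (CFC.sqrt_nonneg E)
    ((CFC.isUnit_sqrt_iff E hE).2 hu)
  rw [hg] at h
  simpa [CFC.sqrt_mul_sqrt_self E hE] using h.symm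

lemma connection_smul_self (hσ : IsConnection σ)
    (hg : ∀ x : ℝ≥0, σ ((x : ℝ) • (1 : H →L[ℂ] H)) 1 = (g x : ℝ) • (1 : H →L[ℂ] H))
    {E : H →L[ℂ] H} (hE : 0 ≤ E) (x : ℝ≥0) :
    σ ((x : ℝ) • E) E = (g x : ℝ) • E := by
  have hpos (n : ℕ) : 0 ≤ E + (invSucc n : ℝ) • (1 : H →L[ℂ] H) :=
    add_nonneg hE (smul_one_nonneg _)
  have h := hσ.tendsto (fun n => smul_nonneg x.2 (hpos n)) hpos
    (fun m n h => smul_le_smul_of_nonneg_left (antitone_add_invSucc_smul E h) x.2)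
    (antitone_add_invSucc_smul E)
    ((tendsto_add_invSucc_smul E).const_smul (x : ℝ)) (tendsto_add_invSucc_smul E)
  refine h.unique (SOTTendsto.of_tendsto ?_)
  have := (tendsto_add_invSucc_smul E).const_smul (g x : ℝ)
  refine this.congr fun n => ?_
  exact (connection_smul_self_of_isUnit hσ hg (hpos n) (isUnit_add_invSucc_smul hE n) x).symm

lemma connection_le_smul (hσ : IsConnection σ)
    (hg : ∀ x : ℝ≥0, σ ((x : ℝ) • (1 : H →L[ℂ] H)) 1 = (g x : ℝ) • (1 : H →L[ℂ] H))
    {Y E : H →L[ℂ] H} (hY : 0 ≤ Y) (b : ℝ≥0) (hE : 1 ≤ E) (hYE : Y ≤ (b : ℝ) • E) :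
    σ Y 1 ≤ (g b : ℝ) • E := by
  rw [← connection_smul_self hσ hg (zero_le_one.trans hE) b]
  exact hσ.le hY zero_le_one hYE hE

lemma smul_le_connection (hσ : IsConnection σ)
    (hg : ∀ x : ℝ≥0, σ ((x : ℝ) • (1 : H →L[ℂ] H)) 1 = (g x : ℝ) • (1 : H →L[ℂ] H))
    {Y E : H →L[ℂ] H} (a : ℝ≥0) (hE : 0 ≤ E) (hE1 : E ≤ 1) (hYE : (a : ℝ) • E ≤ Y) :
    (g a : ℝ) • E ≤ σ Y 1 := by
  rw [← connection_smul_self hσ hg hE a]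
  exact hσ.le (smul_nonneg a.2 hE) hE hYE hE1

lemma anticommutator_nonneg (hσ : IsConnection σ) {Y k : H →L[ℂ] H} (hY : 0 ≤ Y) (hk : 0 ≤ k)
    (hkY : Commute k Y) : 0 ≤ k * σ Y 1 + σ Y 1 * k := by
  have hφ := hσ.nonneg hY zero_le_one
  have main (t : ℝ) (ht : 0 < t) : 0 ≤ (k * σ Y 1 + σ Y 1 * k) + t • (k * σ Y 1 * k) := by
    have htk : 0 ≤ t • k := smul_nonneg ht.le hk
    have hC1 : 1 ≤ 1 + t • k := le_add_of_nonneg_right htk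
    have hC0 : 0 ≤ 1 + t • k := zero_le_one.trans hC1
    have hC : IsUnit (1 + t • k) :=
      isUnit_of_smul_one_le (δ := 1) one_pos (by simpa using hC1)
    have h := hσ.conjugate_eq hY zero_le_one hC0 hC
    have hkY' : 0 ≤ k * Y := hkY.mul_nonneg hk hY
    have hkYk : 0 ≤ k * Y * k := (IsSelfAdjoint.of_nonneg hk).conjugate_nonneg hY
    have hYC : Y ≤ (1 + t • k) * Y * (1 + t • k) := by
      have : (1 + t • k) * Y * (1 + t • k) =
          Y + ((2 * t) • (k * Y) + (t * t) • (k * Y * k)) := by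
        simp only [add_mul, mul_add, one_mul, mul_one, smul_mul_assoc, mul_smul_comm, ← hkY.eq]
        module
      rw [this]
      refine le_add_of_nonneg_right (add_nonneg (smul_nonneg ?_ hkY') (smul_nonneg ?_ hkYk)) <;>
        positivity
    have h1C : 1 ≤ (1 + t • k) * 1 * (1 + t • k) := by
      have : (1 + t • k) * 1 * (1 + t • k) = 1 + ((2 * t) • k + (t * t) • (k * 1 * k)) := by
        simp only [add_mul, mul_add, one_mul, mul_one, smul_mul_assoc, mul_smul_comm]
        module
      rw [this]
      refine le_add_of_nonneg_right (add_nonneg (smul_nonneg ?_ hk) (smul_nonneg ?_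
        ((IsSelfAdjoint.of_nonneg hk).conjugate_nonneg zero_le_one))) <;>
        positivity
    have h2 := hσ.le hY zero_le_one hYC h1C
    rw [← h, ← sub_nonneg] at h2
    have h3 : (1 + t • k) * σ Y 1 * (1 + t • k) - σ Y 1 =
        t • ((k * σ Y 1 + σ Y 1 * k) + t • (k * σ Y 1 * k)) := by
      simp only [add_mul, mul_add, one_mul, mul_one, smul_mul_assoc, mul_smul_comm]
      module
    rw [h3] at h2
    simpa [smul_smul, ht.ne'] using smul_nonneg (inv_nonneg.2 ht.le) h2
  have hlim : Tendsto (fun n => (k * σ Y 1 + σ Y 1 * k) + (invSucc n : ℝ) • (k * σ Y 1 * k)) atTop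
      (𝓝 (k * σ Y 1 + σ Y 1 * k)) := by
    have h := (NNReal.tendsto_coe.2 tendsto_invSucc).smul_const (k * σ Y 1 * k)
    simpa using h.const_add (k * σ Y 1 + σ Y 1 * k)
  exact ge_of_tendsto' hlim fun n => main _ (NNReal.coe_pos.2 (invSucc_pos n))

lemma le_of_smul_one_le_smul_one [Nontrivial H] {a b : ℝ}
    (h : a • (1 : H →L[ℂ] H) ≤ b • (1 : H →L[ℂ] H)) : a ≤ b := by
  by_contra! hab
  have h1 : b • (1 : H →L[ℂ] H) ≤ a • (1 : H →L[ℂ] H) :=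
    smul_le_smul_of_nonneg_right hab.le zero_le_one
  exact hab.ne' (smul_left_injective ℝ (one_ne_zero (α := H →L[ℂ] H)) (le_antisymm h h1))

lemma representing_monotone [Nontrivial H] (hσ : IsConnection σ)
    (hg : ∀ x : ℝ≥0, σ ((x : ℝ) • (1 : H →L[ℂ] H)) 1 = (g x : ℝ) • (1 : H →L[ℂ] H)) :
    Monotone g := fun a b hab => by
  refine NNReal.coe_le_coe.1 (le_of_smul_one_le_smul_one (H := H) ?_)
  rw [← hg, ← hg]
  exact hσ.le (smul_one_nonneg a) zero_le_one
    (smul_le_smul_of_nonneg_right (NNReal.coe_le_coe.2 hab) zero_le_one) le_rfl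

lemma representing_le_max [Nontrivial H] (hσ : IsConnection σ)
    (hg : ∀ x : ℝ≥0, σ ((x : ℝ) • (1 : H →L[ℂ] H)) 1 = (g x : ℝ) • (1 : H →L[ℂ] H))
    (s : ℝ≥0) {x : ℝ≥0} (hx : x ≠ 0) : g s ≤ g x * max 1 (s / x) := by
  refine NNReal.coe_le_coe.1 (le_of_smul_one_le_smul_one (H := H) ?_)
  rw [← hg, NNReal.coe_mul, mul_smul]
  refine connection_le_smul hσ hg (smul_one_nonneg s) x ?_ ?_
  · conv_lhs => rw [← one_smul ℝ (1 : H →L[ℂ] H)]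
    exact smul_le_smul_of_nonneg_right (by exact_mod_cast le_max_left _ _) zero_le_one
  · rw [smul_smul]
    refine smul_le_smul_of_nonneg_right ?_ zero_le_one
    have : s ≤ x * max 1 (s / x) := by
      calc s = x * (s / x) := (mul_div_cancel₀ s hx).symm
        _ ≤ _ := by gcongr; exact le_max_right _ _
    exact_mod_cast this

lemma min_le_representing [Nontrivial H] (hσ : IsConnection σ)
    (hg : ∀ x : ℝ≥0, σ ((x : ℝ) • (1 : H →L[ℂ] H)) 1 = (g x : ℝ) • (1 : H →L[ℂ] H))
    (s : ℝ≥0) {x : ℝ≥0} (hx : x ≠ 0) : g x * min 1 (s / x) ≤ g s := by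
  refine NNReal.coe_le_coe.1 (le_of_smul_one_le_smul_one (H := H) ?_)
  rw [← hg, NNReal.coe_mul, mul_smul]
  refine smul_le_connection hσ hg x (smul_one_nonneg _) ?_ ?_
  · conv_rhs => rw [← one_smul ℝ (1 : H →L[ℂ] H)]
    exact smul_le_smul_of_nonneg_right (by exact_mod_cast min_le_left _ _) zero_le_one
  · rw [smul_smul]
    refine smul_le_smul_of_nonneg_right ?_ zero_le_one
    have : x * min 1 (s / x) ≤ s := by
      calc x * min 1 (s / x) ≤ x * (s / x) := by gcongr; exact min_le_right _ _
        _ = s := mul_div_cancel₀ s hx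
    exact_mod_cast this

lemma representing_tendsto_zero [Nontrivial H] (hσ : IsConnection σ)
    (hg : ∀ x : ℝ≥0, σ ((x : ℝ) • (1 : H →L[ℂ] H)) 1 = (g x : ℝ) • (1 : H →L[ℂ] H)) :
    Tendsto (fun n => g (invSucc n)) atTop (𝓝 (g 0)) := by
  have h0 : Tendsto (fun n => (invSucc n : ℝ) • (1 : H →L[ℂ] H)) atTop (𝓝 0) := by
    simpa using (NNReal.tendsto_coe.2 tendsto_invSucc).smul_const (1 : H →L[ℂ] H)
  have h := hσ.tendsto (fun n => smul_one_nonneg (invSucc n)) (fun _ => zero_le_one)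
    (fun m n h => smul_le_smul_of_nonneg_right (NNReal.coe_le_coe.2 (invSucc_antitone h))
      zero_le_one) antitone_const h0 tendsto_const_nhds
  have hg0 := hg 0
  rw [NNReal.coe_zero, zero_smul] at hg0
  simp only [hg, hg0] at h
  obtain ⟨x, hx⟩ := exists_ne (0 : H)
  have h1 := (h x).norm
  simp only [smul_apply, one_apply_eq_self, norm_smul, NNReal.norm_eq] at h1
  have hx' : ‖x‖ ≠ 0 := norm_ne_zero_iff.2 hx
  have h2 := h1.mul_const ‖x‖⁻¹
  simp only [mul_inv_cancel_right₀ hx'] at h2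
  exact NNReal.tendsto_coe.1 h2

lemma representing_continuous [Nontrivial H] (hσ : IsConnection σ)
    (hg : ∀ x : ℝ≥0, σ ((x : ℝ) • (1 : H →L[ℂ] H)) 1 = (g x : ℝ) • (1 : H →L[ℂ] H)) :
    Continuous g := by
  rw [continuous_iff_continuousAt]
  intro x
  rcases eq_or_ne x 0 with rfl | hx
  · refine tendsto_order.2 ⟨fun a ha => Eventually.of_forall fun s =>
      ha.trans_le (representing_monotone hσ hg zero_le), fun a ha => ?_⟩
    obtain ⟨n, hn⟩ := ((representing_tendsto_zero hσ hg).eventually_lt_const ha).exists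
    filter_upwards [Iio_mem_nhds (invSucc_pos n)] with s hs
    exact (representing_monotone hσ hg (le_of_lt hs)).trans_lt hn
  · have hc1 : ContinuousAt (fun s : ℝ≥0 => g x * min 1 (s / x)) x := by
      fun_prop (disch := exact hx)
    have hc2 : ContinuousAt (fun s : ℝ≥0 => g x * max 1 (s / x)) x := by
      fun_prop (disch := exact hx)
    have h1 := hc1.tendsto
    have h2 := hc2.tendsto
    simp only [div_self hx, min_self, max_self, mul_one] at h1 h2
    exact tendsto_of_tendsto_of_tendsto_of_le_of_le h1 h2
      (fun s => min_le_representing hσ hg s hx) (fun s => representing_le_max hσ hg s hx)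

/-- The connection `Y σ 1` is the functional calculus of the transposed representing function. -/
lemma connection_one_eq_cfc [Nontrivial H] (hσ : IsConnection σ)
    (hg : ∀ x : ℝ≥0, σ ((x : ℝ) • (1 : H →L[ℂ] H)) 1 = (g x : ℝ) • (1 : H →L[ℂ] H))
    {Y : H →L[ℂ] H} (hY : 0 ≤ Y) : σ Y 1 = cfc g Y := by
  have hφ := hσ.nonneg hY zero_le_one
  have hYs : IsSelfAdjoint Y := .of_nonneg hY
  have hgc := representing_continuous hσ hg
  have hc : Commute Y (σ Y 1) := commute_of_anticommutator_nonneg hYs (.of_nonneg hφ)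
    fun k hk hkY => anticommutator_nonneg hσ hY hk hkY
  let G : ℝ → ℝ := fun s => g s.toNNReal
  have hG : Continuous G := by fun_prop
  have hspec : ∀ s ∈ spectrum ℝ Y, 0 ≤ s := fun s hs => spectrum_nonneg_of_nonneg hY hs
  rw [cfc_nnreal_eq_real g Y hY]
  change σ Y 1 = cfc G Y
  have hcG : Commute Y (cfc G Y) := ((Commute.refl Y).cfc_real G).symm
  have upper (b : ℝ≥0) (hb : b ≠ 0) : σ Y 1 ≤ cfc (fun s : ℝ => (g b : ℝ) * max 1 (s / b)) Y := by
    have hm : Continuous fun s : ℝ => max 1 (s / b) := by fun_prop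
    rw [cfc_const_mul (g b : ℝ) (fun s : ℝ => max 1 (s / b)) Y hm.continuousOn]
    refine connection_le_smul hσ hg hY b ?_ ?_
    · rw [← cfc_one ℝ Y]
      exact cfc_mono (fun s _ => le_max_left _ _) continuousOn_const hm.continuousOn
    · rw [← cfc_const_mul (b : ℝ) (fun s : ℝ => max 1 (s / b)) Y hm.continuousOn]
      conv_lhs => rw [← cfc_id ℝ Y]
      refine cfc_mono (fun s _ => ?_) continuousOn_id (hm.const_mul _).continuousOn
      calc id s = b * (s / b) := (mul_div_cancel₀ s (NNReal.coe_ne_zero.2 hb)).symm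
        _ ≤ _ := by gcongr; exact le_max_right _ _
  have lower (a : ℝ≥0) (ha : a ≠ 0) : cfc (fun s : ℝ => (g a : ℝ) * min 1 (s / a)) Y ≤ σ Y 1 := by
    have hm : Continuous fun s : ℝ => min 1 (s / a) := by fun_prop
    rw [cfc_const_mul (g a : ℝ) (fun s : ℝ => min 1 (s / a)) Y hm.continuousOn]
    refine smul_le_connection hσ hg a ?_ ?_ ?_
    · exact cfc_nonneg fun s hs => le_min zero_le_one (div_nonneg (hspec s hs) a.2)
    · rw [← cfc_one ℝ Y]
      exact cfc_mono (fun s _ => min_le_left _ _) hm.continuousOn continuousOn_const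
    · rw [← cfc_const_mul (a : ℝ) (fun s : ℝ => min 1 (s / a)) Y hm.continuousOn]
      conv_rhs => rw [← cfc_id ℝ Y]
      refine cfc_mono (fun s _ => ?_) (hm.const_mul _).continuousOn continuousOn_id
      calc (a : ℝ) * min 1 (s / a) ≤ a * (s / a) := by gcongr; exact min_le_right _ _
        _ = id s := mul_div_cancel₀ s (NNReal.coe_ne_zero.2 ha)
  have lower0 : cfc (fun _ : ℝ => (g 0 : ℝ)) Y ≤ σ Y 1 := by
    rw [cfc_const (g 0 : ℝ) Y, Algebra.algebraMap_eq_smul_one, ← hg]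
    exact hσ.le (smul_one_nonneg 0) zero_le_one (by simpa using hY) le_rfl
  apply le_antisymm
  · rw [← sub_nonpos]
    refine nonpos_of_le_cfc hYs (hc.sub_right hcG) fun s hs η hη => ?_
    obtain ⟨b, hb, hbη⟩ : ∃ b : ℝ≥0, b ≠ 0 ∧ (g b : ℝ) * max 1 (s / b) - G s < η := by
      rcases (hspec s hs).eq_or_lt with rfl | hs0
      · have ht := (NNReal.tendsto_coe.2 (representing_tendsto_zero hσ hg)).eventually_lt_const
          (lt_add_of_pos_right (g 0 : ℝ) hη)
        obtain ⟨n, hn⟩ := ht.exists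
        refine ⟨invSucc n, (invSucc_pos n).ne', ?_⟩
        simp [G]
        linarith
      · refine ⟨s.toNNReal, (Real.toNNReal_pos.2 hs0).ne', ?_⟩
        simp [G, Real.coe_toNNReal s hs0.le, div_self hs0.ne', hη]
    have hm : Continuous fun s : ℝ => (g b : ℝ) * max 1 (s / b) := by fun_prop
    refine ⟨fun s => (g b : ℝ) * max 1 (s / b) - G s, hm.sub hG, ?_, hbη⟩
    rw [cfc_sub (fun s : ℝ => (g b : ℝ) * max 1 (s / b)) G Y hm.continuousOn hG.continuousOn]
    exact sub_le_sub_right (upper b hb) _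
  · rw [← sub_nonpos]
    refine nonpos_of_le_cfc hYs (hcG.sub_right hc) fun s hs η hη => ?_
    obtain ⟨k, hk, hkφ, hkη⟩ : ∃ k : ℝ → ℝ, Continuous k ∧ cfc k Y ≤ σ Y 1 ∧ G s - k s < η := by
      rcases (hspec s hs).eq_or_lt with rfl | hs0
      · exact ⟨_, continuous_const, lower0, by simpa [G] using hη⟩
      · refine ⟨_, by fun_prop, lower s.toNNReal (Real.toNNReal_pos.2 hs0).ne', ?_⟩
        simp [G, Real.coe_toNNReal s hs0.le, div_self hs0.ne', hη]
    refine ⟨fun s => G s - k s, hG.sub hk, ?_, hkη⟩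
    rw [cfc_sub G k Y hG.continuousOn hk.continuousOn]
    exact sub_le_sub_left hkφ _

end Transpose

section TwoByTwo

/-- The functional calculus of an operator with at most two spectral values. -/
lemma cfc_smul_one_add_smul_projection {P : H →L[ℂ] H} (hP : IsStarProjection P) (g : ℝ≥0 → ℝ≥0)
    (p q : ℝ≥0) :
    0 ≤ (p : ℝ) • (1 : H →L[ℂ] H) + ((q : ℝ) - p) • P ∧
    cfc g ((p : ℝ) • (1 : H →L[ℂ] H) + ((q : ℝ) - p) • P) =
      (g p : ℝ) • (1 : H →L[ℂ] H) + ((g q : ℝ) - g p) • P := by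
  have hPs : IsSelfAdjoint P := hP.isSelfAdjoint
  have hspec : spectrum ℝ P ⊆ {0, 1} := hP.isIdempotentElem.spectrum_subset ℝ
  have hlin (c d : ℝ) : c • (1 : H →L[ℂ] H) + (d - c) • P =
      cfc (fun x : ℝ => c + (d - c) * x) P := by
    rw [cfc_const_add c (fun x : ℝ => (d - c) * x) P, cfc_const_mul_id (d - c) P,
      Algebra.algebraMap_eq_smul_one]
  have hpos : 0 ≤ (p : ℝ) • (1 : H →L[ℂ] H) + ((q : ℝ) - p) • P := by
    rw [hlin]
    refine cfc_nonneg fun x hx => ?_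
    rcases hspec hx with rfl | rfl <;> simp
  refine ⟨hpos, ?_⟩
  have hfin : (spectrum ℝ P).Finite := (Set.toFinite {0, 1}).subset hspec
  rw [cfc_nnreal_eq_real g _ hpos, hlin, hlin,
    ← cfc_comp' (fun x : ℝ => (g x.toNNReal : ℝ)) (fun x : ℝ => (p : ℝ) + (q - p) * x) P
      ((hfin.image _).continuousOn _)]
  refine cfc_congr fun x hx => ?_
  rcases hspec hx with rfl | rfl <;> simp

/-- The real symmetric rank-one operator on `ℂ²` attached to the vector `(a, b)`. -/
def rankOneOp (a b : ℝ) : EuclideanSpace ℂ (Fin 2) →L[ℂ] EuclideanSpace ℂ (Fin 2) :=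
  InnerProductSpace.rankOne ℂ !₂[(a : ℂ), b] !₂[(a : ℂ), b]

lemma rankOneOp_nonneg (a b : ℝ) : 0 ≤ rankOneOp a b :=
  (nonneg_iff_isPositive _).2 (InnerProductSpace.isPositive_rankOne_self _)

lemma rankOneOp_apply (a b : ℝ) (x : EuclideanSpace ℂ (Fin 2)) :
    rankOneOp a b x = (a * x 0 + b * x 1 : ℂ) • !₂[(a : ℂ), b] := by
  simp [rankOneOp, PiLp.inner_apply, mul_comm]

lemma smul_one_add_smul_rankOneOp_apply_zero (p q a b : ℝ) (x : EuclideanSpace ℂ (Fin 2)) :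
    (p • (1 : EuclideanSpace ℂ (Fin 2) →L[ℂ] EuclideanSpace ℂ (Fin 2)) + q • rankOneOp a b) x 0 =
      p * x 0 + q * ((a * x 0 + b * x 1) * a) := by
  simp [rankOneOp_apply]

lemma smul_one_add_smul_rankOneOp_apply_one (p q a b : ℝ) (x : EuclideanSpace ℂ (Fin 2)) :
    (p • (1 : EuclideanSpace ℂ (Fin 2) →L[ℂ] EuclideanSpace ℂ (Fin 2)) + q • rankOneOp a b) x 1 =
      p * x 1 + q * ((a * x 0 + b * x 1) * b) := by
  simp [rankOneOp_apply]

lemma isStarProjection_inv_smul {R : H →L[ℂ] H} (hR : IsSelfAdjoint R) {c : ℝ} (hc : c ≠ 0)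
    (h : R * R = c • R) : IsStarProjection (c⁻¹ • R) := by
  refine ⟨?_, (IsSelfAdjoint.all (c⁻¹)).smul hR⟩
  rw [IsIdempotentElem, smul_mul_assoc, mul_smul_comm, h, smul_smul c⁻¹ c, inv_mul_cancel₀ hc,
    one_smul]

lemma rankOneOp_mul_self (a b : ℝ) :
    rankOneOp a b * rankOneOp a b = (a * a + b * b) • rankOneOp a b := by
  ext x i
  change rankOneOp a b (rankOneOp a b x) i = ((a * a + b * b) • rankOneOp a b x) i
  fin_cases i <;> simp [rankOneOp_apply] <;> ring

lemma smul_one_add_smul_rankOneOp_le {p q a b p' q' a' b' : ℝ}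
    (s c d : ℝ) (hs : 0 ≤ s)
    (h₀ : p' + q' * (a' * a') - (p + q * (a * a)) = s * (c * c))
    (h₁ : q' * (a' * b') - q * (a * b) = s * (c * d))
    (h₂ : p' + q' * (b' * b') - (p + q * (b * b)) = s * (d * d)) :
    p • (1 : EuclideanSpace ℂ (Fin 2) →L[ℂ] EuclideanSpace ℂ (Fin 2)) + q • rankOneOp a b ≤
      p' • (1 : EuclideanSpace ℂ (Fin 2) →L[ℂ] EuclideanSpace ℂ (Fin 2)) +
        q' • rankOneOp a' b' := by
  rw [← sub_nonneg]
  convert smul_nonneg hs (rankOneOp_nonneg c d)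
  have e₀ := congrArg (fun r : ℝ => (r : ℂ)) h₀
  have e₁ := congrArg (fun r : ℝ => (r : ℂ)) h₁
  have e₂ := congrArg (fun r : ℝ => (r : ℂ)) h₂
  push_cast at e₀ e₁ e₂
  ext x i
  rw [_root_.sub_apply, PiLp.sub_apply]
  fin_cases i
  · simp only [Fin.zero_eta, smul_one_add_smul_rankOneOp_apply_zero, _root_.smul_apply,
      rankOneOp_apply]
    simp
    linear_combination x 0 * e₀ + x 1 * e₁
  · simp only [Fin.mk_one, smul_one_add_smul_rankOneOp_apply_one, _root_.smul_apply,
      rankOneOp_apply]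
    simp
    linear_combination x 0 * e₁ + x 1 * e₂

lemma first_entry_le {p q a b p' q' a' b' : ℝ}
    (h : p • (1 : EuclideanSpace ℂ (Fin 2) →L[ℂ] EuclideanSpace ℂ (Fin 2)) + q • rankOneOp a b ≤
      p' • (1 : EuclideanSpace ℂ (Fin 2) →L[ℂ] EuclideanSpace ℂ (Fin 2)) + q' • rankOneOp a' b') :
    p + q * (a * a) ≤ p' + q' * (a' * a') := by
  have h1 := ((nonneg_iff_isPositive _).1 (sub_nonneg.2 h)).re_inner_nonneg_right
    (EuclideanSpace.single 0 1)
  rw [EuclideanSpace.inner_single_left, _root_.sub_apply, PiLp.sub_apply,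
    smul_one_add_smul_rankOneOp_apply_zero, smul_one_add_smul_rankOneOp_apply_zero] at h1
  simp at h1
  linarith

/-- Comparison of the `(0, 0)` matrix entries of `g(A) ≤ g(B)` for `2 × 2` matrices
`A ≤ B` with `B - A` of rank one. -/
lemma OperatorMonotone.two_by_two {g : ℝ≥0 → ℝ≥0} (hg : OperatorMonotone g) {p q p' q' : ℝ≥0}
    {a b a' b' s x y : ℝ} (hs : 0 ≤ s) (hc : a * a + b * b ≠ 0) (hc' : a' * a' + b' * b' ≠ 0)
    (h₀ : p' + (q' - p') * (a' * a' + b' * b')⁻¹ * (a' * a') -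
      (p + (q - p) * (a * a + b * b)⁻¹ * (a * a)) = s * (x * x))
    (h₁ : (q' - p') * (a' * a' + b' * b')⁻¹ * (a' * b') -
      (q - p) * (a * a + b * b)⁻¹ * (a * b) = s * (x * y))
    (h₂ : p' + (q' - p') * (a' * a' + b' * b')⁻¹ * (b' * b') -
      (p + (q - p) * (a * a + b * b)⁻¹ * (b * b)) = s * (y * y)) :
    g p + ((g q : ℝ) - g p) * (a * a + b * b)⁻¹ * (a * a) ≤
      g p' + ((g q' : ℝ) - g p') * (a' * a' + b' * b')⁻¹ * (a' * a') := by
  have hP := isStarProjection_inv_smul (IsSelfAdjoint.of_nonneg (rankOneOp_nonneg a b)) hc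
    (rankOneOp_mul_self a b)
  have hP' := isStarProjection_inv_smul (IsSelfAdjoint.of_nonneg (rankOneOp_nonneg a' b')) hc'
    (rankOneOp_mul_self a' b')
  obtain ⟨hA, hgA⟩ := cfc_smul_one_add_smul_projection hP g p q
  obtain ⟨hB, hgB⟩ := cfc_smul_one_add_smul_projection hP' g p' q'
  rw [smul_smul] at hA hgA hB hgB
  rw [smul_smul] at hgA hgB
  have hle := smul_one_add_smul_rankOneOp_le s x y hs h₀ h₁ h₂
  have hmono := hg _ _ _ ((nonneg_iff_isPositive _).1 hA) ((nonneg_iff_isPositive _).1 hB) hle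
  rw [hgA, hgB] at hmono
  exact first_entry_le hmono

end TwoByTwo

/-- An operator monotone function that takes the same value at `a < b` is bounded by this value
above `b`. -/
lemma OperatorMonotone.le_of_eq_of_lt {g : ℝ≥0 → ℝ≥0} (hg : OperatorMonotone g) {a b t : ℝ≥0}
    (hab : a < b) (hbt : b < t) (h : g a = g b) : g t ≤ g b := by
  have hab' : (a : ℝ) < b := mod_cast hab
  have hbt' : (b : ℝ) < t := mod_cast hbt
  have hu : 0 ≤ (b : ℝ) - a := by linarith
  have hv : 0 ≤ 2 * ((t : ℝ) - a) - (b - a) := by linarith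
  set u := √((b : ℝ) - a)
  set v := √(2 * ((t : ℝ) - a) - (b - a))
  have huu : u * u = (b : ℝ) - a := Real.mul_self_sqrt hu
  have hvv : v * v = 2 * ((t : ℝ) - a) - (b - a) := Real.mul_self_sqrt hv
  have hc : u * u + v * v = 2 * ((t : ℝ) - a) := by rw [huu, hvv]; ring
  have hd : (t : ℝ) - a ≠ 0 := by linarith
  have hq : ((2 * t - b : ℝ≥0) : ℝ) = 2 * t - b := by
    rw [NNReal.coe_sub]
    · simp
    · rw [← NNReal.coe_le_coe]; push_cast; linarith
  have key := hg.two_by_two (p := a) (q := t) (p' := b) (q' := 2 * t - b) (a := u) (b := v)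
    (a' := 0) (b' := 1) (s := 1 / 2) (x := u) (y := -v) (by norm_num)
    (by rw [hc]; simpa using hd) (by norm_num)
    (by rw [hc, huu]; field_simp; ring)
    (by rw [hc]; field_simp; ring)
    (by rw [hc, hq, neg_mul_neg, hvv]; field_simp; ring)
  rw [hc, huu, h] at key
  have h2 : ((g t : ℝ) - g b) * ((2 * ((t : ℝ) - a))⁻¹ * (b - a)) ≤ 0 := by
    simp only [mul_zero, add_zero] at key
    linarith
  have h3 : 0 < (2 * ((t : ℝ) - a))⁻¹ * (b - a) :=
    mul_pos (inv_pos.2 (by linarith)) (by linarith)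
  rw [← NNReal.coe_le_coe]
  nlinarith

/-- An operator monotone function that takes the same value at `a < b` is bounded below by this
value on `(0, a)`. -/
lemma OperatorMonotone.ge_of_eq_of_lt {g : ℝ≥0 → ℝ≥0} (hg : OperatorMonotone g) {a b t : ℝ≥0}
    (ht : 0 < t) (hta : t < a) (hab : a < b) (h : g a = g b) : g b ≤ g t := by
  have ht' : (0 : ℝ) < t := mod_cast ht
  have hta' : (t : ℝ) < a := mod_cast hta
  have hab' : (a : ℝ) < b := mod_cast hab
  have ha : (0 : ℝ) < a := ht'.trans hta'
  have hb : (0 : ℝ) < b := ha.trans hab'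
  set α := √((b : ℝ) - a)
  set β := √(t : ℝ)
  set γ := √(b : ℝ)
  set δ := √((a : ℝ) - t)
  have hα : α ^ 2 = (b : ℝ) - a := Real.sq_sqrt (by linarith)
  have hβ : β ^ 2 = (t : ℝ) := Real.sq_sqrt ht'.le
  have hγ : γ ^ 2 = (b : ℝ) := Real.sq_sqrt hb.le
  have hδ : δ ^ 2 = (a : ℝ) - t := Real.sq_sqrt (by linarith)
  have haa : (α * β) * (α * β) = ((b : ℝ) - a) * t := by rw [← hα, ← hβ]; ring
  have hbb : (γ * δ) * (γ * δ) = (b : ℝ) * (a - t) := by rw [← hγ, ← hδ]; ring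
  have hc : (α * β) * (α * β) + (γ * δ) * (γ * δ) = ((b : ℝ) - t) * a := by rw [haa, hbb]; ring
  have hd : (b : ℝ) - t ≠ 0 := by linarith
  have key := hg.two_by_two (p := a) (q := 0) (p' := b) (q' := t) (a := 0) (b := 1)
    (a' := α * β) (b' := γ * δ) (s := (a : ℝ)⁻¹) (x := α * δ) (y := -(γ * β))
    (inv_nonneg.2 ha.le) (by norm_num)
    (by rw [hc]; exact mul_ne_zero hd ha.ne')
    (by
      have hxx : (α * δ) * (α * δ) = ((b : ℝ) - a) * (a - t) := by rw [← hα, ← hδ]; ring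
      rw [hc, haa, hxx]; field_simp; ring)
    (by rw [hc]; field_simp; ring)
    (by
      have hyy : -(γ * β) * -(γ * β) = (b : ℝ) * t := by rw [← hγ, ← hβ]; ring
      rw [hc, hbb, hyy]; simp only [NNReal.coe_zero]; field_simp; ring)
  rw [hc, haa, h] at key
  have h2 : 0 ≤ ((g t : ℝ) - g b) * ((((b : ℝ) - t) * a)⁻¹ * ((b - a) * t)) := by
    simp only [mul_zero, add_zero] at key
    linarith
  have h3 : 0 < (((b : ℝ) - t) * a)⁻¹ * ((b - a) * t) :=
    mul_pos (inv_pos.2 (mul_pos (by linarith) ha)) (mul_pos (by linarith) ht')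
  rw [← NNReal.coe_le_coe]
  have := nonneg_of_mul_nonneg_left h2 h3
  linarith

/-- A continuous operator monotone function is injective or constant. -/
lemma OperatorMonotone.eq_of_not_injective {g : ℝ≥0 → ℝ≥0} (hg : OperatorMonotone g)
    (hm : Monotone g) (hc : Continuous g) (hi : ¬ Function.Injective g) :
    ∃ k, ∀ t, g t = k := by
  obtain ⟨a, b, hab, h⟩ : ∃ a b, a < b ∧ g a = g b := by
    simp only [Function.Injective, not_forall] at hi
    obtain ⟨a, b, h, hne⟩ := hi
    rcases lt_or_gt_of_ne hne with hlt | hlt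
    exacts [⟨a, b, hlt, h⟩, ⟨b, a, hlt, h.symm⟩]
  have hpos (t : ℝ≥0) (ht : 0 < t) : g t = g b := by
    rcases lt_or_ge t a with hta | hat
    · exact le_antisymm (hm (hta.trans hab).le) (hg.ge_of_eq_of_lt ht hta hab h)
    rcases le_or_gt t b with htb | hbt
    · exact le_antisymm (hm htb) (h ▸ hm hat)
    · exact le_antisymm (hg.le_of_eq_of_lt hab hbt h) (hm hbt.le)
  refine ⟨g b, fun t => ?_⟩
  rcases eq_or_ne t 0 with rfl | ht
  · have h0 : Tendsto g (𝓝[>] 0) (𝓝 (g 0)) := hc.continuousWithinAt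
    refine tendsto_nhds_unique (h0.congr' ?_) tendsto_const_nhds
    filter_upwards [self_mem_nhdsWithin] with t ht using hpos t ht
  · exact hpos t (pos_iff_ne_zero.2 ht)

/-- The inverse of a continuous strictly monotone function is continuous on the range. -/
lemma continuousOn_invFun_range {g : ℝ≥0 → ℝ≥0} (hm : StrictMono g) (hc : Continuous g) :
    ContinuousOn (Function.invFun g) (Set.range g) := by
  have := (isPreconnected_range hc).ordConnected
  have hemb : IsEmbedding g := hm.isEmbedding_of_ordConnected this
  rw [continuousOn_iff_continuous_domRestrict]
  have : (Set.range g).domRestrict (Function.invFun g) = hemb.toHomeomorph.symm := by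
    ext ⟨_, x, rfl⟩
    have : hemb.toHomeomorph.symm ⟨g x, x, rfl⟩ = x :=
      hemb.toHomeomorph.symm_apply_eq.2 rfl
    simp [Function.leftInverse_invFun hm.injective x, this]
  rw [this]
  exact hemb.toHomeomorph.symm.continuous

section RightEquation

variable {σ : (H →L[ℂ] H) → (H →L[ℂ] H) → (H →L[ℂ] H)} {g : ℝ≥0 → ℝ≥0}

/-- The square root of an invertible positive operator is inverted by `A ^ (-1/2)`. -/
lemma sqrt_rpow_neg_half {A : H →L[ℂ] H} (hA : 0 ≤ A) (hAu : IsUnit A) :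
    CFC.sqrt A * CFC.rpow A (-(1/2) : ℝ) = 1 ∧ CFC.rpow A (-(1/2) : ℝ) * CFC.sqrt A = 1 := by
  have hA' : IsStrictlyPositive A := IsStrictlyPositive.iff_of_unital.2 ⟨hA, hAu⟩
  rw [CFC.sqrt_eq_rpow]
  exact ⟨CFC.rpow_mul_rpow_neg (1 / 2) hA', CFC.rpow_neg_mul_rpow (1 / 2) hA'⟩

lemma mul_mul_cancel_of_inverse {S R : H →L[ℂ] H} (h₁ : S * R = 1) (h₂ : R * S = 1)
    (X : H →L[ℂ] H) : S * (R * X * R) * S = X := by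
  calc S * (R * X * R) * S = (S * R) * X * (R * S) := by simp only [mul_assoc]
    _ = X := by rw [h₁, h₂, one_mul, mul_one]

/-- Representation of a connection through its transposed representing function. -/
lemma connection_eq_sqrt_mul_cfc [Nontrivial H] (hσ : IsConnection σ)
    (hg : ∀ x : ℝ≥0, σ ((x : ℝ) • (1 : H →L[ℂ] H)) 1 = (g x : ℝ) • (1 : H →L[ℂ] H))
    {X A : H →L[ℂ] H} (hX : 0 ≤ X) (hA : 0 ≤ A) (hAu : IsUnit A) :
    σ X A = CFC.sqrt A *
      cfc g (CFC.rpow A (-(1/2) : ℝ) * X * CFC.rpow A (-(1/2) : ℝ)) * CFC.sqrt A := by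
  obtain ⟨h₁, h₂⟩ := sqrt_rpow_neg_half hA hAu
  have hR : 0 ≤ CFC.rpow A (-(1/2) : ℝ) := CFC.rpow_nonneg
  have hY := (IsSelfAdjoint.of_nonneg hR).conjugate_nonneg hX
  have hS : IsUnit (CFC.sqrt A) := ⟨⟨_, _, h₁, h₂⟩, rfl⟩
  rw [← connection_one_eq_cfc hσ hg hY, hσ.conjugate_eq hY zero_le_one (CFC.sqrt_nonneg A) hS,
    mul_mul_cancel_of_inverse h₁ h₂, mul_one, CFC.sqrt_mul_sqrt_self A hA]

/-- A connection whose transposed representing function is constant is a multiple of the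
right-trivial mean. -/
lemma eq_smul_of_representing_const [Nontrivial H] (hσ : IsConnection σ)
    (hg : ∀ x : ℝ≥0, σ ((x : ℝ) • (1 : H →L[ℂ] H)) 1 = (g x : ℝ) • (1 : H →L[ℂ] H))
    {k : ℝ≥0} (hk : ∀ x, g x = k) {A B : H →L[ℂ] H} (hA : 0 ≤ A) (hB : 0 ≤ B) :
    σ A B = (k : ℝ) • B := by
  have hunit {D : H →L[ℂ] H} (hD : 0 ≤ D) (hu : IsUnit D) : σ A D = (k : ℝ) • D := by
    have hY : 0 ≤ CFC.rpow D (-(1/2) : ℝ) * A * CFC.rpow D (-(1/2) : ℝ) :=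
      (IsSelfAdjoint.of_nonneg CFC.rpow_nonneg).conjugate_nonneg hA
    rw [connection_eq_sqrt_mul_cfc hσ hg hA hD hu, funext hk, cfc_const k _ hY,
      Algebra.algebraMap_eq_smul_one, NNReal.smul_def, mul_smul_comm, mul_one, smul_mul_assoc,
      CFC.sqrt_mul_sqrt_self D hD]
  have hnn (n : ℕ) : 0 ≤ B + (invSucc n : ℝ) • (1 : H →L[ℂ] H) := add_nonneg hB (smul_one_nonneg _)
  have hlim := hσ.tendsto (fun _ => hA) hnn (fun _ _ _ => le_rfl) (antitone_add_invSucc_smul B)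
    tendsto_const_nhds (tendsto_add_invSucc_smul B)
  refine hlim.unique (SOTTendsto.of_tendsto ?_)
  simp only [hunit (hnn _) (isUnit_add_invSucc_smul hB _)]
  exact (tendsto_add_invSucc_smul B).const_smul _

lemma representing_strictMono [Nontrivial H] (hσ : IsConnection σ)
    (hnr : ¬ ∃ k : ℝ≥0, ∀ A B : H →L[ℂ] H, A.IsPositive → B.IsPositive → σ A B = (k : ℝ) • B)
    (hgm : OperatorMonotone g)
    (hg : ∀ x : ℝ≥0, σ ((x : ℝ) • (1 : H →L[ℂ] H)) 1 = (g x : ℝ) • (1 : H →L[ℂ] H)) :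
    StrictMono g := by
  refine (representing_monotone hσ hg).strictMono_of_injective ?_
  by_contra hi
  obtain ⟨k, hk⟩ := hgm.eq_of_not_injective (representing_monotone hσ hg)
    (representing_continuous hσ hg) hi
  exact hnr ⟨k, fun A B hA hB => eq_smul_of_representing_const hσ hg hk
    ((nonneg_iff_isPositive A).2 hA) ((nonneg_iff_isPositive B).2 hB)⟩

end RightEquation

/-- Solvability and the solution of the equation `X σ A = B`
for a connection that is not a scalar multiple of the right-trivial mean; `g` is the
representing function of the transpose connection `(A, B) ↦ B σ A`. -/
theorem solve_right_equation [Nontrivial H]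
    (σ : (H →L[ℂ] H) → (H →L[ℂ] H) → (H →L[ℂ] H)) (hσ : IsConnection σ)
    (hnr : ¬ ∃ k : ℝ≥0, ∀ A B : H →L[ℂ] H, A.IsPositive → B.IsPositive →
      σ A B = (k : ℝ) • B)
    (g : ℝ≥0 → ℝ≥0) (hg : IsRepresentingFunction (fun A B => σ B A) g)
    (A B : H →L[ℂ] H) (hA : A.IsPositive) (hAu : IsUnit A) (hB : B.IsPositive) :
    ((∃ X : H →L[ℂ] H, X.IsPositive ∧ σ X A = B) ↔
      spectrum ℝ≥0 (CFC.rpow A (-(1/2) : ℝ) * B * CFC.rpow A (-(1/2) : ℝ)) ⊆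
        Set.range g) ∧
    ∀ X : H →L[ℂ] H, X.IsPositive → σ X A = B →
      X = CFC.sqrt A *
            cfc (Function.invFun g)
              (CFC.rpow A (-(1/2) : ℝ) * B * CFC.rpow A (-(1/2) : ℝ)) *
          CFC.sqrt A := by
  obtain ⟨hgm, hg⟩ := hg
  replace hA := (nonneg_iff_isPositive A).2 hA
  replace hB := (nonneg_iff_isPositive B).2 hB
  have hc := representing_continuous hσ hg
  have hs := representing_strictMono hσ hnr hgm hg
  have hinv := Function.leftInverse_invFun hs.injective
  have hci := continuousOn_invFun_range hs hc
  obtain ⟨h₁, h₂⟩ := sqrt_rpow_neg_half hA hAu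
  have hR : 0 ≤ CFC.rpow A (-(1/2) : ℝ) := CFC.rpow_nonneg
  have hsol {X : H →L[ℂ] H} (hX : 0 ≤ X) := connection_eq_sqrt_mul_cfc hσ hg hX hA hAu
  set S := CFC.sqrt A
  set R := CFC.rpow A (-(1/2) : ℝ)
  have hconj {X : H →L[ℂ] H} (hX : 0 ≤ X) : 0 ≤ R * X * R :=
    (IsSelfAdjoint.of_nonneg hR).conjugate_nonneg hX
  have hred {X : H →L[ℂ] H} (hX : 0 ≤ X) (hXB : σ X A = B) : cfc g (R * X * R) = R * B * R := by
    rw [← hXB, hsol hX, mul_mul_cancel_of_inverse h₂ h₁]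
  refine ⟨⟨?_, fun hsp => ?_⟩, fun X hX hXB => ?_⟩
  · rintro ⟨X, hX, hXB⟩
    replace hX := (nonneg_iff_isPositive X).2 hX
    rw [← hred hX hXB, cfc_map_spectrum g (R * X * R) (hconj hX) hc.continuousOn]
    exact Set.image_subset_range _ _
  · have hY : 0 ≤ cfc (Function.invFun g) (R * B * R) := cfc_nonneg fun _ _ => zero_le
    have hX : 0 ≤ S * cfc (Function.invFun g) (R * B * R) * S :=
      (IsSelfAdjoint.of_nonneg (CFC.sqrt_nonneg A)).conjugate_nonneg hY
    refine ⟨_, (nonneg_iff_isPositive _).1 hX, ?_⟩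
    rw [hsol hX, mul_mul_cancel_of_inverse h₂ h₁,
      ← cfc_comp' g (Function.invFun g) (R * B * R) hc.continuousOn (hci.mono hsp) (hconj hB),
      cfc_congr (g := fun x => x) fun x hx => Function.invFun_eq (hsp hx),
      cfc_id' ℝ≥0 (R * B * R) (hconj hB), mul_mul_cancel_of_inverse h₁ h₂]
  · replace hX := (nonneg_iff_isPositive X).2 hX
    rw [← hred hX hXB, ← cfc_comp' (Function.invFun g) g (R * X * R)
      (hci.mono (Set.image_subset_range _ _)) hc.continuousOn (hconj hX)]
    simp only [hinv _]
    rw [cfc_id' ℝ≥0 (R * X * R) (hconj hX), mul_mul_cancel_of_inverse h₁ h₂]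

end
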